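/- The truncation deflation factor ψ is strictly increasing on ℝ: for all s₀ < s₁, ψ(s₀) < ψ(s₁), where ψ(s) = λ(s)(λ(s) − s) and λ(s) = φ(s)/(1−Φ(s)). (Hence ψ monotonically increases with the severity of truncation Φ(s₀).) -/

import Mathlib

open MeasureTheory ProbabilityTheory

/-- Standard normal pdf. -/
noncomputable def stdPhi (s : ℝ) : ℝ := (Real.sqrt (2 * Real.pi))⁻¹ * Real.exp (-(s ^ 2) / 2)

/-- Standard normal cdf. -/
noncomputable def stdPhiCDF (s : ℝ) : ℝ := ∫ t in Set.Iic s, stdPhi t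

/-- Standard normal hazard function `λ(s) = φ(s)/(1 − Φ(s))`. -/
noncomputable def hazardN (s : ℝ) : ℝ := stdPhi s / (1 - stdPhiCDF s)

/-- Truncation deflation factor `ψ(s) = λ(s)(λ(s) − s)`. -/
noncomputable def psiN (s : ℝ) : ℝ := hazardN s * (hazardN s - s)

/-- Covariance of two real random variables under a measure. -/
noncomputable def covM {Ω : Type*} [MeasurableSpace Ω] (μ : Measure Ω) (X Y : Ω → ℝ) : ℝ :=
  (∫ ω, X ω * Y ω ∂μ) - (∫ ω, X ω ∂μ) * (∫ ω, Y ω ∂μ)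

/-- Partial covariance, adjusting for a standardized covariate `S`. -/
noncomputable def covAdj {Ω : Type*} [MeasurableSpace Ω] (μ : Measure Ω) (X Y S : Ω → ℝ) : ℝ :=
  covM μ X Y - covM μ X S * covM μ Y S

lemma stdPhi_pos (s : ℝ) : 0 < stdPhi s := by
  unfold stdPhi
  positivity

lemma stdPhi_eq_gaussianPDFReal : stdPhi = gaussianPDFReal 0 1 := by
  ext s
  simp [stdPhi, gaussianPDFReal]

lemma continuous_stdPhi : Continuous stdPhi := by
  unfold stdPhi
  fun_prop

lemma integrable_stdPhi : Integrable stdPhi := by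
  rw [stdPhi_eq_gaussianPDFReal]
  exact integrable_gaussianPDFReal 0 1

lemma integral_stdPhi : ∫ t, stdPhi t = 1 := by
  rw [stdPhi_eq_gaussianPDFReal]
  exact integral_gaussianPDFReal_eq_one 0 one_ne_zero

lemma hasDerivAt_stdPhi (s : ℝ) : HasDerivAt stdPhi (-s * stdPhi s) s := by
  have h : HasDerivAt (fun x : ℝ => -(x ^ 2) / 2) (-s) s := by
    refine (((hasDerivAt_id s).pow 2).neg.div_const 2).congr_deriv ?_
    simp only [id, Nat.cast_ofNat]
    ring
  refine (h.exp.const_mul (Real.sqrt (2 * Real.pi))⁻¹).congr_deriv ?_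
  unfold stdPhi
  ring

lemma tendsto_stdPhi_atTop : Filter.Tendsto stdPhi Filter.atTop (nhds 0) := by
  have h : Filter.Tendsto (fun x : ℝ => -(x ^ 2) / 2) Filter.atTop Filter.atBot :=
    (Filter.tendsto_neg_atTop_atBot.comp
      (Filter.tendsto_pow_atTop two_ne_zero)).atBot_div_const two_pos
  have := (Real.tendsto_exp_atBot.comp h).const_mul (Real.sqrt (2 * Real.pi))⁻¹
  rwa [mul_zero] at this

lemma hasDerivAt_stdPhiCDF (s : ℝ) : HasDerivAt stdPhiCDF (stdPhi s) s := by
  have h : stdPhiCDF = fun x => (∫ t in (0 : ℝ)..x, stdPhi t) + stdPhiCDF 0 := by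
    ext x
    have := intervalIntegral.integral_Iic_sub_Iic (μ := volume) (a := 0) (b := x)
      integrable_stdPhi.integrableOn integrable_stdPhi.integrableOn
    unfold stdPhiCDF
    linarith
  rw [h]
  exact (continuous_stdPhi.integral_hasStrictDerivAt 0 s).hasDerivAt.add_const _

lemma tendsto_stdPhiCDF_atTop : Filter.Tendsto stdPhiCDF Filter.atTop (nhds 1) := by
  rw [← integral_stdPhi]
  exact (aecover_Iic Filter.tendsto_id).integral_tendsto_of_countably_generated integrable_stdPhi

/-- A function with positive derivative on `(a, ∞)` and limit `l` at infinity stays below `l`. -/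
lemma lt_of_hasDerivAt_pos_of_tendsto {f f' : ℝ → ℝ} {a l : ℝ}
    (hf : ∀ x, a < x → HasDerivAt f (f' x) x) (hf' : ∀ x, a < x → 0 < f' x)
    (hl : Filter.Tendsto f Filter.atTop (nhds l)) {x : ℝ} (hx : a < x) : f x < l := by
  have hmono : StrictMonoOn f (Set.Ioi a) := by
    refine strictMonoOn_of_deriv_pos (convex_Ioi a)
      (fun y hy => (hf y hy).continuousAt.continuousWithinAt) fun y hy => ?_
    rw [interior_Ioi] at hy
    rw [(hf y hy).deriv]
    exact hf' y hy
  have hx' : a < x + 1 := by linarith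
  refine (hmono hx hx' (lt_add_one x)).trans_le (ge_of_tendsto hl ?_)
  filter_upwards [Filter.eventually_ge_atTop (x + 1)] with y hy
  exact hmono.monotoneOn hx' (hx'.trans_le hy) hy

lemma stdPhiCDF_lt_one (s : ℝ) : stdPhiCDF s < 1 :=
  lt_of_hasDerivAt_pos_of_tendsto (a := s - 1) (fun x _ => hasDerivAt_stdPhiCDF x)
    (fun x _ => stdPhi_pos x) tendsto_stdPhiCDF_atTop (by linarith)

lemma hazardN_pos (s : ℝ) : 0 < hazardN s :=
  div_pos (stdPhi_pos s) (sub_pos.2 (stdPhiCDF_lt_one s))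

lemma three_mul_add_sqrt_pos {s : ℝ} (hs : -1 < s) : 0 < 3 * s + Real.sqrt (s ^ 2 + 8) := by
  have hr := Real.sqrt_nonneg (s ^ 2 + 8)
  have hr2 := Real.sq_sqrt (show 0 ≤ s ^ 2 + 8 by positivity)
  by_contra! h
  nlinarith

lemma mul_sq_add_six_lt_sqrt_mul (s : ℝ) :
    s * (s ^ 2 + 6) < Real.sqrt (s ^ 2 + 8) * (s ^ 2 + 2) := by
  refine lt_of_pow_lt_pow_left₀ 2 (by positivity) ?_
  rw [mul_pow, mul_pow, Real.sq_sqrt (by positivity)]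
  nlinarith

/-- Sampford's upper bound for the Gaussian tail. -/
lemma one_sub_stdPhiCDF_lt {s : ℝ} (hs : -1 < s) :
    1 - stdPhiCDF s < 4 * stdPhi s / (3 * s + Real.sqrt (s ^ 2 + 8)) := by
  have hD (x : ℝ) :
      HasDerivAt (fun x => 3 * x + Real.sqrt (x ^ 2 + 8)) (3 + x / Real.sqrt (x ^ 2 + 8)) x := by
    have h1 : HasDerivAt (fun x : ℝ => x ^ 2 + 8) (2 * x) x := by
      simpa using ((hasDerivAt_id x).pow 2).add_const 8
    refine (((hasDerivAt_id x).const_mul 3).add (h1.sqrt (by positivity))).congr_deriv ?_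
    have : 0 < Real.sqrt (x ^ 2 + 8) := by positivity
    field_simp
  have hlim : Filter.Tendsto
      (fun x => 1 - stdPhiCDF x - 4 * stdPhi x / (3 * x + Real.sqrt (x ^ 2 + 8)))
      Filter.atTop (nhds 0) := by
    have hDtop : Filter.Tendsto (fun x : ℝ => 3 * x + Real.sqrt (x ^ 2 + 8))
        Filter.atTop Filter.atTop :=
      Filter.Tendsto.atTop_add_nonneg
        (Filter.tendsto_id.const_mul_atTop three_pos) fun x => Real.sqrt_nonneg _
    simpa using (tendsto_stdPhiCDF_atTop.const_sub 1).sub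
      ((tendsto_stdPhi_atTop.const_mul 4).div_atTop hDtop)
  refine sub_neg.1 (lt_of_hasDerivAt_pos_of_tendsto (a := -1) (fun x hx =>
    ((hasDerivAt_stdPhiCDF x).const_sub 1).sub (((hasDerivAt_stdPhi x).const_mul 4).div (hD x)
      (three_mul_add_sqrt_pos hx).ne')) (fun x hx => ?_) hlim hs)
  have hDpos := three_mul_add_sqrt_pos hx
  have key := mul_sq_add_six_lt_sqrt_mul x
  have hDne := hDpos.ne'
  have hr2 := Real.sq_sqrt (show 0 ≤ x ^ 2 + 8 by positivity)
  have hr : 0 < Real.sqrt (x ^ 2 + 8) := by positivity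
  generalize Real.sqrt (x ^ 2 + 8) = r at *
  have heq : -stdPhi x - (4 * (-x * stdPhi x) * (3 * x + r) - 4 * stdPhi x * (3 + x / r)) /
      (3 * x + r) ^ 2 =
      stdPhi x * (2 * (r * (x ^ 2 + 2) - x * (x ^ 2 + 6))) / (r * (3 * x + r) ^ 2) := by
    rw [eq_div_iff (by positivity), sub_mul, mul_comm r, ← mul_assoc (_ / _),
      div_mul_cancel₀ _ (by positivity)]
    field_simp
    linear_combination stdPhi x * (-r - 2 * x) * hr2
  rw [heq]
  have := stdPhi_pos x
  have := sub_pos.2 key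
  positivity

lemma one_lt_hazardN_sub_mul (s : ℝ) : 1 < (hazardN s - s) * (2 * hazardN s - s) := by
  have hpos := hazardN_pos s
  rcases le_or_gt s (-1) with hs | hs
  · nlinarith
  · have hD := three_mul_add_sqrt_pos hs
    have hb : 3 * s + Real.sqrt (s ^ 2 + 8) < 4 * hazardN s := by
      have h := one_sub_stdPhiCDF_lt hs
      rw [lt_div_iff₀ hD] at h
      rw [hazardN, ← mul_div_assoc, lt_div_iff₀ (sub_pos.2 (stdPhiCDF_lt_one s))]
      linarith
    have hr := Real.sqrt_nonneg (s ^ 2 + 8)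
    have hr2 := Real.sq_sqrt (show 0 ≤ s ^ 2 + 8 by positivity)
    nlinarith

lemma hasDerivAt_hazardN (s : ℝ) : HasDerivAt hazardN (psiN s) s := by
  have hQ := (sub_pos.2 (stdPhiCDF_lt_one s)).ne'
  refine ((hasDerivAt_stdPhi s).div ((hasDerivAt_stdPhiCDF s).const_sub 1) hQ).congr_deriv ?_
  unfold psiN hazardN
  field_simp
  ring

lemma hasDerivAt_psiN (s : ℝ) :
    HasDerivAt psiN (hazardN s * ((hazardN s - s) * (2 * hazardN s - s) - 1)) s := by
  have h := hasDerivAt_hazardN s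
  refine (h.mul (h.sub (hasDerivAt_id s))).congr_deriv ?_
  simp only [psiN, Pi.sub_apply, id]
  ring

lemma strictMono_psiN : StrictMono psiN :=
  strictMono_of_hasDerivAt_pos hasDerivAt_psiN fun s =>
    mul_pos (hazardN_pos s) (sub_pos.2 (one_lt_hazardN_sub_mul s))

theorem stmt16 : ∀ s₀ s₁ : ℝ, s₀ < s₁ → psiN s₀ < psiN s₁ := by
  exact fun _ _ h => strictMono_psiN h
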